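/- Let X be an asymptotic ℓ_p space, 1 ≤ p < ∞, with a basis, and let (η_n) and η = lim_n η_n^{1/n} be its refined lower asymptotic constants. Then for every M ∈ ℕ there is a block sequence (x_i) in X with (supp x_i)_i ⊂ S_r for some r ∈ ℕ, such that for every i ∈ ℕ and every 1 ≤ j < M there exists an S_j-admissible sequence (E_k) of finite subsets of ℕ with ‖x_i‖^p ≤ 2 η^j Σ_k ‖E_k x_i‖^p. -/

import Mathlib

open Finset Filter


/-- The minimum of a finite set of naturals (0 for the empty set). -/
noncomputable def fmin (s : Finset ℕ) : ℕ := sInf (s : Set ℕ)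

/-- The Schreier families `S_n`, `n ∈ ℕ`. -/
def SchreierNat : ℕ → Set (Finset ℕ)
  | 0 => {F | F.card ≤ 1}
  | n + 1 => {F | ∃ (k : ℕ) (E : Fin k → Finset ℕ),
      (∀ i, E i ∈ SchreierNat n) ∧
      (∀ i j : Fin k, i < j → ∀ a ∈ E i, ∀ b ∈ E j, a < b) ∧
      (∀ i, ∀ a ∈ E i, k ≤ a) ∧
      F = Finset.univ.biUnion E}

/-- The Schreier family `S_ω`, defined using the sequence `n ↗ ω`. -/
def SchreierOmega : Set (Finset ℕ) :=
  {F | ∃ n : ℕ, F ∈ SchreierNat n ∧ ∀ a ∈ F, n ≤ a}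

/-- A finite sequence `E 0 < E 1 < … < E (k-1)` of nonempty finite subsets of `ℕ` is
`𝒮`-admissible if the set of minima belongs to `𝒮`. -/
def SAdmissible (𝒮 : Set (Finset ℕ)) {k : ℕ} (E : Fin k → Finset ℕ) : Prop :=
  (∀ i, (E i).Nonempty) ∧
  (∀ i j : Fin k, i < j → ∀ a ∈ E i, ∀ b ∈ E j, a < b) ∧
  Finset.image (fun i => fmin (E i)) Finset.univ ∈ 𝒮

/-- Restriction `E x` of a finitely supported vector `x` to a set `E` of coordinates. -/
noncomputable def restr (E : Finset ℕ) (x : ℕ →₀ ℝ) : ℕ →₀ ℝ :=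
  Finsupp.filter (· ∈ E) x

/-- The sup norm `‖x‖_∞` of a finitely supported vector. -/
noncomputable def fsupNorm (x : ℕ →₀ ℝ) : ℝ := ⨆ i, |x i|

/-- `Tn` is (a norm satisfying the implicit equation of) the `p`-convexified mixed
Tsirelson space `T^{(p)}[(S_n, θ_n)_{n ∈ N}]`, as a function on `c₀₀`. -/
def IsMixedTsirelsonNorm (p : ℝ) (N : Set ℕ) (θ : ℕ → ℝ) (Tn : (ℕ →₀ ℝ) → ℝ) : Prop :=
  ∀ x : ℕ →₀ ℝ,
    Tn x = max (fsupNorm x)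
      (sSup {r : ℝ | ∃ n ∈ N, ∃ (k : ℕ) (E : Fin k → Finset ℕ),
        SAdmissible (SchreierNat n) E ∧
        r = θ n ^ (1 / p) * (∑ i, Tn (restr (E i) x) ^ p) ^ (1 / p)})

/-- `Tn` is (a norm satisfying the implicit equation of) the `p`-convexified
Tsirelson-type space `T^{(p)}[S₁, θ] = T^{(p)}_θ`, as a function on `c₀₀`. -/
def IsT1Norm (p θ : ℝ) (Tn : (ℕ →₀ ℝ) → ℝ) : Prop :=
  IsMixedTsirelsonNorm p {1} (fun _ => θ) Tn

/-- Regularity of the sequence of parameters: `(θ_n) ⊂ (0,1)`, `θ_n ↘ 0` and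
`θ_{n+m} ≥ θ_n θ_m`. -/
def RegularParams (θ : ℕ → ℝ) : Prop :=
  (∀ n, 0 < θ n ∧ θ n < 1) ∧ Antitone θ ∧
    Tendsto θ atTop (nhds 0) ∧ ∀ n m, θ n * θ m ≤ θ (n + m)

section VecCore

variable {Y : Type*} [NormedAddCommGroup Y] [NormedSpace ℝ Y]

/-- The vector `∑_i a_i y_i` determined by finitely many coefficients. -/
noncomputable def vec (y : ℕ → Y) (a : ℕ →₀ ℝ) : Y := a.sum fun i c => c • y i

/-- `x` is a basic sequence: nonzero vectors satisfying the Grunblum criterion. -/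
def IsBasicSeq (x : ℕ → Y) : Prop :=
  (∀ i, x i ≠ 0) ∧
  ∃ C : ℝ, 1 ≤ C ∧ ∀ (a : ℕ → ℝ) (n m : ℕ), n ≤ m →
    ‖∑ i ∈ Finset.range n, a i • x i‖ ≤ C * ‖∑ i ∈ Finset.range m, a i • x i‖

/-- A seminormalized sequence. -/
def Seminormalized (x : ℕ → Y) : Prop :=
  ∃ c C : ℝ, 0 < c ∧ ∀ i, c ≤ ‖x i‖ ∧ ‖x i‖ ≤ C

/-- `𝒮`-unconditionality of a sequence, for a family `𝒮` of finite subsets of `ℕ`. -/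
def FUnconditional (𝒮 : Set (Finset ℕ)) (x : ℕ → Y) : Prop :=
  ∃ C : ℝ, 1 ≤ C ∧ ∀ (a : ℕ →₀ ℝ), ∀ F ∈ 𝒮,
    ‖∑ i ∈ F, a i • x i‖ ≤ C * ‖vec x a‖

/-- An unconditional sequence. -/
def UnconditionalSeq (x : ℕ → Y) : Prop :=
  ∃ C : ℝ, 1 ≤ C ∧ ∀ (a : ℕ →₀ ℝ) (F : Finset ℕ),
    ‖∑ i ∈ F, a i • x i‖ ≤ C * ‖vec x a‖

/-- The closed linear span `[y_i]` contains an isomorphic copy of `c₀`: it contains a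
sequence equivalent to the unit vector basis of `c₀`. -/
def SpanContainsC0 (y : ℕ → Y) : Prop :=
  ∃ z : ℕ → Y, (∀ k, z k ∈ closure (Submodule.span ℝ (Set.range y) : Set Y)) ∧
    ∃ c C : ℝ, 0 < c ∧ ∀ a : ℕ →₀ ℝ,
      c * (⨆ i, |a i|) ≤ ‖vec z a‖ ∧ ‖vec z a‖ ≤ C * (⨆ i, |a i|)

/-- `[y_i]` contains the spaces `c₀ⁿ` uniformly: there is `C ≥ 1` such that for every
`n` there are `n` disjointly supported vectors `C`-equivalent to the unit vector
basis of `c₀ⁿ`. -/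
def ContainsC0nUniformly (y : ℕ → Y) : Prop :=
  ∃ C : ℝ, 1 ≤ C ∧ ∀ n : ℕ, ∃ b : Fin n → (ℕ →₀ ℝ),
    (∀ j k, j ≠ k → Disjoint (b j).support (b k).support) ∧
    ∀ a : Fin n → ℝ,
      (1 / C) * (⨆ j, |a j|) ≤ ‖∑ j, a j • vec y (b j)‖ ∧
      ‖∑ j, a j • vec y (b j)‖ ≤ C * (⨆ j, |a j|)

/-- `e` is a (Schauder) basis of `Y`: nonzero vectors satisfying the Grunblum
criterion whose linear span is dense. -/
def IsSchauderBasis (e : ℕ → Y) : Prop :=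
  (∀ i, e i ≠ 0) ∧
  (∃ C : ℝ, 1 ≤ C ∧ ∀ (a : ℕ → ℝ) (n m : ℕ), n ≤ m →
    ‖∑ i ∈ Finset.range n, a i • e i‖ ≤ C * ‖∑ i ∈ Finset.range m, a i • e i‖) ∧
  Dense (Submodule.span ℝ (Set.range e) : Set Y)

/-- A family of finitely supported coefficient vectors is a block family:
nonempty successive supports. -/
def SuccBlocks {ι : Type*} [Preorder ι] (A : ι → (ℕ →₀ ℝ)) : Prop :=
  (∀ i, (A i).support.Nonempty) ∧
  ∀ i j, i < j → ∀ a ∈ (A i).support, ∀ b ∈ (A j).support, a < b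

end VecCore

section AsymptoticCore

variable {X : Type*} [NormedAddCommGroup X] [NormedSpace ℝ X]

/-- `X` (with basis `e`) is an asymptotic `ℓ_p` space: every normalized block
sequence `n ≤ x₁ < … < x_n` is `C`-equivalent to the unit vector basis of `ℓ_p^n`. -/
def IsAsymptoticLp (p : ℝ) (e : ℕ → X) : Prop :=
  ∃ C : ℝ, 1 ≤ C ∧ ∀ (n : ℕ) (A : Fin n → (ℕ →₀ ℝ)),
    SuccBlocks A → (∀ i, ‖vec e (A i)‖ = 1) → (∀ i, ∀ a ∈ (A i).support, n ≤ a) →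
    ∀ b : Fin n → ℝ,
      (1 / C) * (∑ i, |b i| ^ p) ^ (1 / p) ≤ ‖∑ i, b i • vec e (A i)‖ ∧
      ‖∑ i, b i • vec e (A i)‖ ≤ C * (∑ i, |b i| ^ p) ^ (1 / p)

/-- `t` is a lower `ℓ_p`-estimate constant for `S_n`-admissible block sequences
`n ≤ x₁ < … < x_k` in `X`. -/
def LowerAsympBound (p : ℝ) (e : ℕ → X) (n : ℕ) (t : ℝ) : Prop :=
  ∀ (k : ℕ) (A : Fin k → (ℕ →₀ ℝ)), SuccBlocks A →
    (∀ i, ∀ a ∈ (A i).support, n ≤ a) →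
    Finset.image (fun i => fmin (A i).support) Finset.univ ∈ SchreierNat n →
    t * ∑ i, ‖vec e (A i)‖ ^ p ≤ ‖∑ i, vec e (A i)‖ ^ p

/-- The lower asymptotic constant `θ_n = θ_n(X)`: the biggest `t ∈ (0,1]`
satisfying the lower `ℓ_p` estimate on `S_n`-admissible block sequences. -/
noncomputable def lowerAsympConst (p : ℝ) (e : ℕ → X) (n : ℕ) : ℝ :=
  sSup {t : ℝ | 0 < t ∧ t ≤ 1 ∧ LowerAsympBound p e n t}

end AsymptoticCore

section Eta

variable {X : Type*} [NormedAddCommGroup X] [NormedSpace ℝ X]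

/-- `t` is a lower `ℓ_p`-estimate constant for `S_n`-admissible subsequences of
the block sequence determined by `A`. -/
def EtaBound (p : ℝ) (e : ℕ → X) (A : ℕ → (ℕ →₀ ℝ)) (n : ℕ) (t : ℝ) : Prop :=
  ∀ (k : ℕ) (ι : Fin k → ℕ), StrictMono ι →
    Finset.image (fun j => fmin (A (ι j)).support) Finset.univ ∈ SchreierNat n →
    ∀ a : Fin k → ℝ, t * ∑ j, |a j| ^ p ≤ ‖∑ j, a j • vec e (A (ι j))‖ ^ p

/-- The constant `η̃_n(x)` for a block sequence `x` determined by `A`. -/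
noncomputable def etaTilde (p : ℝ) (e : ℕ → X) (A : ℕ → (ℕ →₀ ℝ)) (n : ℕ) : ℝ :=
  sSup {t : ℝ | 0 < t ∧ t ≤ 1 ∧ EtaBound p e A n t}

/-- The constant `η_n(x) = sup_k η̃_n((x_i)_{i ≥ k})`. -/
noncomputable def etaOfSeq (p : ℝ) (e : ℕ → X) (A : ℕ → (ℕ →₀ ℝ)) (n : ℕ) : ℝ :=
  ⨆ k : ℕ, etaTilde p e (fun i => A (i + k)) n

/-- The refined lower asymptotic constant `η_n`: the infimum of `η_n(x)` over all
normalized block sequences `x` with supports of uniformly bounded admissibility. -/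
noncomputable def etaConst (p : ℝ) (e : ℕ → X) (n : ℕ) : ℝ :=
  sInf {r : ℝ | ∃ A : ℕ → (ℕ →₀ ℝ), SuccBlocks A ∧ (∀ i, ‖vec e (A i)‖ = 1) ∧
    (∃ r₀ : ℕ, ∀ i, (A i).support ∈ SchreierNat r₀) ∧ r = etaOfSeq p e A n}

end Eta

section Schreier

theorem fmin_mem {s : Finset ℕ} (h : s.Nonempty) : fmin s ∈ s := by
  have := Nat.sInf_mem (s := (s : Set ℕ)) (by simpa using h)
  simpa [fmin] using this

theorem fmin_le {s : Finset ℕ} {a : ℕ} (h : a ∈ s) : fmin s ≤ a :=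
  Nat.sInf_le (by simpa using h)

theorem SchreierNat.mono_subset {n : ℕ} {F G : Finset ℕ} (hF : F ∈ SchreierNat n) (h : G ⊆ F) :
    G ∈ SchreierNat n := by
  induction n generalizing F G with
  | zero => exact (Finset.card_le_card h).trans hF
  | succ n ih =>
    obtain ⟨k, E, hE, hlt, hk, rfl⟩ := hF
    refine ⟨k, fun i => E i ∩ G, fun i => ih (hE i) Finset.inter_subset_left, ?_, ?_, ?_⟩
    · intro i j hij a ha b hb
      exact hlt i j hij a (Finset.mem_inter.1 ha).1 b (Finset.mem_inter.1 hb).1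
    · intro i a ha
      exact hk i a (Finset.mem_inter.1 ha).1
    · ext a
      simp only [Finset.mem_biUnion, Finset.mem_univ, true_and, Finset.mem_inter]
      constructor
      · intro ha
        obtain ⟨i, -, hi⟩ := Finset.mem_biUnion.1 (h ha)
        exact ⟨i, hi, ha⟩
      · rintro ⟨i, -, ha⟩
        exact ha

theorem SchreierNat.empty_mem (n : ℕ) : ∅ ∈ SchreierNat n := by
  cases n with
  | zero => simp [SchreierNat]
  | succ n => exact ⟨0, fun _ => ∅, fun i => i.elim0, fun i => i.elim0, fun i => i.elim0, by simp⟩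

theorem SchreierNat.singleton_mem (n : ℕ) {a : ℕ} (ha : 1 ≤ a) : {a} ∈ SchreierNat n := by
  induction n with
  | zero => simp [SchreierNat]
  | succ n ih =>
    refine ⟨1, fun _ => {a}, fun _ => ih, ?_, ?_, by simp⟩
    · intro i j hij
      exact absurd hij (by simp [Subsingleton.elim i j])
    · simpa using ha

/-- A splitting of `m(F) ∈ S_{n+1}` into members of `S_n`, read on the index set `F`. -/
theorem SchreierNat.exists_split {m : ℕ → ℕ} (hm : StrictMono m) {n : ℕ} {F : Finset ℕ}
    (hF : F.image m ∈ SchreierNat (n + 1)) :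
    ∃ (k : ℕ) (G : Fin k → Finset ℕ), (∀ l, (G l).image m ∈ SchreierNat n) ∧
      (∀ l l' : Fin k, l < l' → ∀ i ∈ G l, ∀ i' ∈ G l', i < i') ∧
      (∀ l, ∀ i ∈ G l, k ≤ m i) ∧ F = Finset.univ.biUnion G := by
  obtain ⟨k, E, hE, hlt, hk, hFE⟩ := hF
  refine ⟨k, fun l => F.filter (fun i => m i ∈ E l), fun l => mono_subset (hE l) ?_, ?_, ?_, ?_⟩
  · intro a ha
    obtain ⟨i, hi, rfl⟩ := Finset.mem_image.1 ha
    exact (Finset.mem_filter.1 hi).2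
  · intro l l' hl i hi i' hi'
    exact hm.lt_iff_lt.1
      (hlt l l' hl _ (Finset.mem_filter.1 hi).2 _ (Finset.mem_filter.1 hi').2)
  · intro l i hi
    exact hk l _ (Finset.mem_filter.1 hi).2
  · ext i
    simp only [Finset.mem_biUnion, Finset.mem_univ, true_and, Finset.mem_filter]
    constructor
    · intro hi
      have : m i ∈ Finset.univ.biUnion E := hFE ▸ Finset.mem_image_of_mem m hi
      obtain ⟨l, -, hl⟩ := Finset.mem_biUnion.1 this
      exact ⟨l, hi, hl⟩
    · rintro ⟨l, hi, -⟩
      exact hi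

/-- The part of `F` from `d` up to the next element of `D`. -/
def segmentFrom (F D : Finset ℕ) (d : ℕ) : Finset ℕ :=
  F.filter fun i => d ≤ i ∧ ∀ d' ∈ D, d' ≤ i → d' ≤ d

theorem mem_segmentFrom {F D : Finset ℕ} {d i : ℕ} :
    i ∈ segmentFrom F D d ↔ i ∈ F ∧ d ≤ i ∧ ∀ d' ∈ D, d' ≤ i → d' ≤ d := by
  simp [segmentFrom]

theorem self_mem_segmentFrom {F D : Finset ℕ} {d : ℕ} (hd : d ∈ F) : d ∈ segmentFrom F D d :=
  mem_segmentFrom.2 ⟨hd, le_rfl, fun _ _ h => h⟩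

theorem segmentFrom_lt {F D : Finset ℕ} {d d' i i' : ℕ} (hd' : d' ∈ D) (h : d < d')
    (hi : i ∈ segmentFrom F D d) (hi' : i' ∈ segmentFrom F D d') : i < i' := by
  by_contra! hle
  have h1 := (mem_segmentFrom.1 hi).2.2 d' hd' ((mem_segmentFrom.1 hi').2.1.trans hle)
  omega

theorem sum_segmentFrom {F D : Finset ℕ} (hD : ∀ i ∈ F, ∃ d ∈ D, d ≤ i) (f : ℕ → ℝ) :
    ∑ d ∈ D, ∑ i ∈ segmentFrom F D d, f i = ∑ i ∈ F, f i := by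
  rw [← Finset.sum_biUnion]
  · congr 1
    ext i
    simp only [Finset.mem_biUnion]
    constructor
    · rintro ⟨d, -, hi⟩
      exact (mem_segmentFrom.1 hi).1
    · intro hi
      obtain ⟨d, hd, hdi⟩ := hD i hi
      obtain ⟨d₀, hd₀, hmax⟩ :=
        (D.filter (· ≤ i)).exists_max_image id ⟨d, Finset.mem_filter.2 ⟨hd, hdi⟩⟩
      rw [Finset.mem_filter] at hd₀
      exact ⟨d₀, hd₀.1, mem_segmentFrom.2 ⟨hi, hd₀.2,
        fun d' h1 h2 => hmax d' (Finset.mem_filter.2 ⟨h1, h2⟩)⟩⟩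
  · intro d hd d' hd' hne
    refine Finset.disjoint_left.2 fun i hi hi' => ?_
    rcases lt_or_gt_of_ne hne with h | h
    · exact lt_irrefl _ (segmentFrom_lt hd' h hi hi')
    · exact lt_irrefl _ (segmentFrom_lt hd h hi' hi)

/-- `S_{n+j} ⊆ S_j[S_n]`, read on index sets: the set `D` collects the first elements of the
members of `S_n`. -/
theorem SchreierNat.exists_segments {m : ℕ → ℕ} (hm : StrictMono m) {n j : ℕ} {F : Finset ℕ}
    (hF : F.image m ∈ SchreierNat (n + j)) :
    ∃ D ⊆ F, D.image m ∈ SchreierNat j ∧ (∀ i ∈ F, ∃ d ∈ D, d ≤ i) ∧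
      ∀ d ∈ D, (segmentFrom F D d).image m ∈ SchreierNat n := by
  induction j generalizing F with
  | zero =>
    rcases F.eq_empty_or_nonempty with rfl | hne
    · exact ⟨∅, by simp, by simpa using SchreierNat.empty_mem 0, by simp, by simp⟩
    · refine ⟨{fmin F}, by simpa using fmin_mem hne, by simp [SchreierNat],
        fun i hi => ⟨_, Finset.mem_singleton_self _, fmin_le hi⟩, fun d _ => ?_⟩
      exact mono_subset hF (Finset.image_subset_image (Finset.filter_subset _ _))
  | succ j ih =>
    obtain ⟨k, G, hG, hlt, hk, rfl⟩ := exists_split hm hF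
    choose D hDG hDj hDle hDn using fun l => ih (hG l)
    refine ⟨Finset.univ.biUnion D, Finset.biUnion_mono fun l _ => hDG l,
      ⟨k, fun l => (D l).image m, hDj, ?_, ?_, Finset.biUnion_image⟩, ?_, ?_⟩
    · intro l l' hl a ha b hb
      obtain ⟨i, hi, rfl⟩ := Finset.mem_image.1 ha
      obtain ⟨i', hi', rfl⟩ := Finset.mem_image.1 hb
      exact hm (hlt l l' hl i (hDG l hi) i' (hDG l' hi'))
    · intro l a ha
      obtain ⟨i, hi, rfl⟩ := Finset.mem_image.1 ha
      exact hk l i (hDG l hi)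
    · intro i hi
      obtain ⟨l, -, hl⟩ := Finset.mem_biUnion.1 hi
      obtain ⟨d, hd, hdi⟩ := hDle l i hl
      exact ⟨d, Finset.mem_biUnion.2 ⟨l, Finset.mem_univ _, hd⟩, hdi⟩
    · intro d hd
      obtain ⟨l, -, hl⟩ := Finset.mem_biUnion.1 hd
      refine mono_subset (hDn l d hl) (Finset.image_subset_image fun i hi => ?_)
      obtain ⟨hiF, hdi, hmax⟩ := mem_segmentFrom.1 hi
      obtain ⟨l', -, hl'⟩ := Finset.mem_biUnion.1 hiF
      have hll : l' = l := by
        rcases lt_trichotomy l' l with h | h | h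
        · exact absurd (hlt l' l h i hl' d (hDG l hl)) (by omega)
        · exact h
        · obtain ⟨d', hd', hd'i⟩ := hDle l' i hl'
          have h1 := hmax d' (Finset.mem_biUnion.2 ⟨l', Finset.mem_univ _, hd'⟩) hd'i
          exact absurd (hlt l l' h d (hDG l hl) d' (hDG l' hd')) (by omega)
      subst hll
      exact mem_segmentFrom.2 ⟨hl', hdi,
        fun d' h1 h2 => hmax d' (Finset.mem_biUnion.2 ⟨l', Finset.mem_univ _, h1⟩) h2⟩

end Schreier

theorem sum_orderEmbOfFin {α Z : Type*} [LinearOrder α] [AddCommMonoid Z] (s : Finset α)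
    (f : α → Z) : ∑ l, f (s.orderEmbOfFin rfl l) = ∑ i ∈ s, f i := by
  calc ∑ l, f (s.orderEmbOfFin rfl l)
      = ∑ i ∈ Finset.univ.map (s.orderEmbOfFin rfl).toEmbedding, f i := by
        rw [Finset.sum_map]; rfl
    _ = ∑ i ∈ s, f i := by rw [Finset.map_orderEmbOfFin_univ]

section Blocks

/-- The map `i ↦ min supp (A i)` of a block sequence. -/
noncomputable def minSupp (A : ℕ → (ℕ →₀ ℝ)) (i : ℕ) : ℕ := fmin (A i).support

/-- The linear combination of blocks `∑_{i ∈ F} a_i A_i`. -/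
noncomputable def blockComb (A : ℕ → (ℕ →₀ ℝ)) (F : Finset ℕ) (a : ℕ → ℝ) : ℕ →₀ ℝ :=
  ∑ i ∈ F, a i • A i

theorem exists_of_mem_support_blockComb {A : ℕ → (ℕ →₀ ℝ)} {F : Finset ℕ} {a : ℕ → ℝ} {x : ℕ}
    (hx : x ∈ (blockComb A F a).support) : ∃ i ∈ F, x ∈ (A i).support := by
  by_contra! h
  rw [Finsupp.mem_support_iff, blockComb, Finsupp.finsetSum_apply] at hx
  refine hx (Finset.sum_eq_zero fun i hi => ?_)
  simp [Finsupp.notMem_support_iff.1 (h i hi)]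

namespace SuccBlocks

variable {A : ℕ → (ℕ →₀ ℝ)}

theorem strictMono_minSupp (hA : SuccBlocks A) : StrictMono (minSupp A) := fun i j hij =>
  hA.2 i j hij _ (fmin_mem (hA.1 i)) _ (fmin_mem (hA.1 j))

theorem lt_of_mem (hA : SuccBlocks A) {i j x y : ℕ} (hij : i < j) (hx : x ∈ (A i).support)
    (hy : y ∈ (A j).support) : x < y := hA.2 i j hij x hx y hy

theorem eq_of_mem (hA : SuccBlocks A) {i j x : ℕ} (hi : x ∈ (A i).support)
    (hj : x ∈ (A j).support) : i = j := by
  rcases lt_trichotomy i j with h | h | h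
  · exact absurd (hA.lt_of_mem h hi hj) (lt_irrefl _)
  · exact h
  · exact absurd (hA.lt_of_mem h hj hi) (lt_irrefl _)

theorem blockComb_apply (hA : SuccBlocks A) {F : Finset ℕ} (a : ℕ → ℝ) {i x : ℕ} (hi : i ∈ F)
    (hx : x ∈ (A i).support) : blockComb A F a x = a i * A i x := by
  rw [blockComb, Finsupp.finsetSum_apply, Finset.sum_eq_single i]
  · simp
  · intro j _ hj
    have : A j x = 0 := by
      by_contra h
      exact hj (hA.eq_of_mem (Finsupp.mem_support_iff.2 h) hx)
    simp [this]
  · exact fun h => absurd hi h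

theorem restr_blockComb (hA : SuccBlocks A) {F G : Finset ℕ} (hG : G ⊆ F) (a : ℕ → ℝ) :
    restr (G.biUnion fun i => (A i).support) (blockComb A F a) = blockComb A G a := by
  ext x
  rw [restr, Finsupp.filter_apply]
  split_ifs with h
  · obtain ⟨i, hi, hx⟩ := Finset.mem_biUnion.1 h
    rw [hA.blockComb_apply a (hG hi) hx, hA.blockComb_apply a hi hx]
  · by_contra hne
    obtain ⟨i, hi, hx⟩ := exists_of_mem_support_blockComb (Finsupp.mem_support_iff.2 (Ne.symm hne))
    exact h (Finset.mem_biUnion.2 ⟨i, hi, hx⟩)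

/-- `S_N[S_r] ⊆ S_{r+N}` for the supports of a block sequence. -/
theorem biUnion_support_mem (hA : SuccBlocks A) {r : ℕ} (hr : ∀ i, (A i).support ∈ SchreierNat r)
    {N : ℕ} {F : Finset ℕ} (hF : F.image (minSupp A) ∈ SchreierNat N) :
    (F.biUnion fun i => (A i).support) ∈ SchreierNat (r + N) := by
  induction N generalizing F with
  | zero =>
    have hcard : F.card ≤ 1 := by
      rw [← Finset.card_image_of_injective F hA.strictMono_minSupp.injective]
      exact hF
    rcases Nat.le_one_iff_eq_zero_or_eq_one.1 hcard with h | h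
    · rw [Finset.card_eq_zero.1 h]
      simpa using SchreierNat.empty_mem r
    · obtain ⟨i, rfl⟩ := Finset.card_eq_one.1 h
      simpa using hr i
  | succ N ih =>
    obtain ⟨k, G, hG, hlt, hk, rfl⟩ := SchreierNat.exists_split hA.strictMono_minSupp hF
    refine ⟨k, fun l => (G l).biUnion fun i => (A i).support, fun l => ih (hG l), ?_, ?_, ?_⟩
    · intro l l' hl x hx y hy
      obtain ⟨i, hi, hx⟩ := Finset.mem_biUnion.1 hx
      obtain ⟨i', hi', hy⟩ := Finset.mem_biUnion.1 hy
      exact hA.lt_of_mem (hlt l l' hl i hi i' hi') hx hy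
    · intro l x hx
      obtain ⟨i, hi, hx⟩ := Finset.mem_biUnion.1 hx
      exact (hk l i hi).trans (fmin_le hx)
    · exact Finset.biUnion_biUnion _ _ _

theorem lt_of_mem_blockComb (hA : SuccBlocks A) {F G : Finset ℕ} (hFG : ∀ i ∈ F, ∀ j ∈ G, i < j)
    {a b : ℕ → ℝ} {x y : ℕ} (hx : x ∈ (blockComb A F a).support)
    (hy : y ∈ (blockComb A G b).support) : x < y := by
  obtain ⟨i, hi, hx⟩ := exists_of_mem_support_blockComb hx
  obtain ⟨j, hj, hy⟩ := exists_of_mem_support_blockComb hy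
  exact hA.lt_of_mem (hFG i hi j hj) hx hy

theorem blockComb_support_nonempty (hA : SuccBlocks A) {F : Finset ℕ} {a : ℕ → ℝ} {i : ℕ}
    (hi : i ∈ F) (ha : a i ≠ 0) : (blockComb A F a).support.Nonempty := by
  obtain ⟨x, hx⟩ := hA.1 i
  refine ⟨x, Finsupp.mem_support_iff.2 ?_⟩
  rw [hA.blockComb_apply a hi hx]
  exact mul_ne_zero ha (Finsupp.mem_support_iff.1 hx)

end SuccBlocks

variable {X : Type*} [NormedAddCommGroup X] [NormedSpace ℝ X]

theorem vec_eq_linearCombination (e : ℕ → X) (b : ℕ →₀ ℝ) :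
    vec e b = Finsupp.linearCombination ℝ e b := rfl

theorem vec_smul (e : ℕ → X) (c : ℝ) (b : ℕ →₀ ℝ) : vec e (c • b) = c • vec e b := by
  simp only [vec_eq_linearCombination, map_smul]

theorem vec_blockComb (e : ℕ → X) (A : ℕ → (ℕ →₀ ℝ)) (F : Finset ℕ) (a : ℕ → ℝ) :
    vec e (blockComb A F a) = ∑ i ∈ F, a i • vec e (A i) := by
  simp only [vec_eq_linearCombination, blockComb, map_sum, map_smul]

/-- The lower estimate of an asymptotic `ℓ_p` space for blocks that are neither normalized nor
nonzero. -/
theorem sum_norm_rpow_le_of_isAsymptoticLp {p : ℝ} (hp : 1 ≤ p) {e : ℕ → X} {C : ℝ} (hC : 1 ≤ C)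
    (h : ∀ (n : ℕ) (A : Fin n → (ℕ →₀ ℝ)),
      SuccBlocks A → (∀ i, ‖vec e (A i)‖ = 1) → (∀ i, ∀ a ∈ (A i).support, n ≤ a) →
      ∀ b : Fin n → ℝ, (1 / C) * (∑ i, |b i| ^ p) ^ (1 / p) ≤ ‖∑ i, b i • vec e (A i)‖)
    {k : ℕ} (y : Fin k → (ℕ →₀ ℝ))
    (hy : ∀ i j, i < j → ∀ a ∈ (y i).support, ∀ b ∈ (y j).support, a < b)
    (hk : ∀ i, ∀ a ∈ (y i).support, k ≤ a) :
    (C ^ p)⁻¹ * ∑ i, ‖vec e (y i)‖ ^ p ≤ ‖∑ i, vec e (y i)‖ ^ p := by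
  classical
  have hp0 : 0 < p := by linarith
  set S : Finset (Fin k) := Finset.univ.filter fun i => vec e (y i) ≠ 0 with hS
  set φ := S.orderEmbOfFin rfl
  have hne : ∀ i, vec e (y (φ i)) ≠ 0 := fun i =>
    (Finset.mem_filter.1 (Finset.orderEmbOfFin_mem S rfl i)).2
  have hnorm : ∀ i, ‖vec e (y (φ i))‖ ≠ 0 := fun i => norm_ne_zero_iff.2 (hne i)
  have hsub : ∀ i, ((‖vec e (y (φ i))‖⁻¹) • y (φ i)).support ⊆ (y (φ i)).support :=
    fun i => Finsupp.support_smul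
  have key := h S.card (fun i => (‖vec e (y (φ i))‖⁻¹) • y (φ i))
    ⟨fun i => by
      rw [Finsupp.support_nonempty_iff]
      refine smul_ne_zero (inv_ne_zero (hnorm i)) fun h0 => hne i ?_
      rw [h0]
      simp [vec], fun i j hij a ha b hb =>
        hy _ _ (φ.strictMono hij) a (hsub i ha) b (hsub j hb)⟩
    (fun i => by
      rw [vec_smul, norm_smul, norm_inv, norm_norm, inv_mul_cancel₀ (hnorm i)])
    (fun i a ha => by
      have h1 := hk _ a (hsub i ha)
      have h2 : S.card ≤ k := by simpa using S.card_le_univ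
      omega)
    (fun i => ‖vec e (y (φ i))‖)
  simp only [vec_smul, smul_smul, mul_inv_cancel₀ (hnorm _), one_smul, abs_norm] at key
  rw [sum_orderEmbOfFin S fun i => vec e (y i), sum_orderEmbOfFin S fun i => ‖vec e (y i)‖ ^ p,
    Finset.sum_subset (f := fun i => vec e (y i)) S.subset_univ
      fun i _ hi => by simpa [hS] using hi,
    Finset.sum_subset (f := fun i => ‖vec e (y i)‖ ^ p) S.subset_univ fun i _ hi => by
      have : vec e (y i) = 0 := by simpa [hS] using hi
      simp [this, hp0.ne']] at key
  have hs0 : 0 ≤ ∑ i, ‖vec e (y i)‖ ^ p := Finset.sum_nonneg fun i _ => by positivity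
  have h1 := Real.rpow_le_rpow (by positivity) key hp0.le
  rwa [Real.mul_rpow (by positivity) (by positivity), ← Real.rpow_mul hs0,
    one_div_mul_cancel hp0.ne', Real.rpow_one, one_div, Real.inv_rpow (by linarith)] at h1

theorem pow_mul_sum_le_of_isAsymptoticLp {p : ℝ} (hp : 1 ≤ p) {e : ℕ → X} {C : ℝ} (hC : 1 ≤ C)
    (h : ∀ (n : ℕ) (A : Fin n → (ℕ →₀ ℝ)),
      SuccBlocks A → (∀ i, ‖vec e (A i)‖ = 1) → (∀ i, ∀ a ∈ (A i).support, n ≤ a) →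
      ∀ b : Fin n → ℝ, (1 / C) * (∑ i, |b i| ^ p) ^ (1 / p) ≤ ‖∑ i, b i • vec e (A i)‖)
    {A : ℕ → (ℕ →₀ ℝ)} (hA : SuccBlocks A) (hA1 : ∀ i, ‖vec e (A i)‖ = 1) (a : ℕ → ℝ) {n : ℕ}
    {F : Finset ℕ} (hF : F.image (minSupp A) ∈ SchreierNat n) :
    ((C ^ p)⁻¹) ^ n * ∑ i ∈ F, |a i| ^ p ≤ ‖∑ i ∈ F, a i • vec e (A i)‖ ^ p := by
  have hp0 : 0 < p := by linarith
  induction n generalizing F with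
  | zero =>
    have hcard : F.card ≤ 1 := by
      rw [← Finset.card_image_of_injective F hA.strictMono_minSupp.injective]
      exact hF
    rcases Nat.le_one_iff_eq_zero_or_eq_one.1 hcard with h | h
    · rw [Finset.card_eq_zero.1 h]
      simp [hp0.ne']
    · obtain ⟨i, rfl⟩ := Finset.card_eq_one.1 h
      simp [norm_smul, hA1]
  | succ n ih =>
    obtain ⟨k, G, hG, hlt, hk, rfl⟩ := SchreierNat.exists_split hA.strictMono_minSupp hF
    have hdisj : ((Finset.univ : Finset (Fin k)) : Set (Fin k)).PairwiseDisjoint G := by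
      intro l _ l' _ hne
      refine Finset.disjoint_left.2 fun i hi hi' => ?_
      rcases lt_or_gt_of_ne hne with h | h
      · exact lt_irrefl _ (hlt l l' h i hi i hi')
      · exact lt_irrefl _ (hlt l' l h i hi' i hi)
    rw [Finset.sum_biUnion hdisj, Finset.sum_biUnion hdisj]
    have h1 := sum_norm_rpow_le_of_isAsymptoticLp hp hC h (fun l => blockComb A (G l) a)
      (fun l l' hl x hx y hy => hA.lt_of_mem_blockComb (hlt l l' hl) hx hy)
      (fun l x hx => by
        obtain ⟨i, hi, hx⟩ := exists_of_mem_support_blockComb hx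
        exact (hk l i hi).trans (fmin_le hx))
    simp only [vec_blockComb] at h1
    refine le_trans ?_ h1
    rw [pow_succ', mul_assoc, Finset.mul_sum]
    gcongr with l _
    exact ih (hG l)

/-- `EtaBound` for a tail of a block sequence, in terms of finite index sets. -/
theorem etaBound_tail_iff {p : ℝ} {e : ℕ → X} {A : ℕ → (ℕ →₀ ℝ)} {K n : ℕ} {t : ℝ} :
    EtaBound p e (fun i => A (i + K)) n t ↔
      ∀ F : Finset ℕ, (∀ i ∈ F, K ≤ i) → F.image (minSupp A) ∈ SchreierNat n → ∀ a : ℕ → ℝ,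
        t * ∑ i ∈ F, |a i| ^ p ≤ ‖∑ i ∈ F, a i • vec e (A i)‖ ^ p := by
  constructor
  · intro h F hK hF a
    have hle : ∀ l, K ≤ F.orderEmbOfFin rfl l := fun l => hK _ (F.orderEmbOfFin_mem rfl l)
    have hcancel : ∀ l, F.orderEmbOfFin rfl l - K + K = F.orderEmbOfFin rfl l :=
      fun l => Nat.sub_add_cancel (hle l)
    have key := h F.card (fun l => F.orderEmbOfFin rfl l - K)
      (fun l l' hl => by
        have := (F.orderEmbOfFin rfl).strictMono hl
        have := hle l
        simp only
        omega)
      (by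
        simp only [hcancel]
        refine SchreierNat.mono_subset hF fun x hx => ?_
        obtain ⟨l, -, rfl⟩ := Finset.mem_image.1 hx
        exact Finset.mem_image.2 ⟨_, F.orderEmbOfFin_mem rfl l, rfl⟩)
      (fun l => a (F.orderEmbOfFin rfl l))
    simp only [hcancel] at key
    rwa [sum_orderEmbOfFin F fun i => |a i| ^ p,
      sum_orderEmbOfFin F fun i => a i • vec e (A i)] at key
  · intro h k ι hι hmem a
    have hinj : Function.Injective fun l => ι l + K := fun l l' hl =>
      hι.injective (Nat.add_right_cancel hl)
    have key := h (Finset.univ.image fun l => ι l + K)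
      (fun i hi => by
        obtain ⟨l, -, rfl⟩ := Finset.mem_image.1 hi
        exact Nat.le_add_left _ _)
      (by rw [Finset.image_image]; exact hmem)
      (Function.extend (fun l => ι l + K) a 0)
    rw [Finset.sum_image (fun _ _ _ _ h => hinj h),
      Finset.sum_image (fun _ _ _ _ h => hinj h)] at key
    simpa only [hinj.extend_apply] using key

end Blocks

section EtaConstants

variable {X : Type*} [NormedAddCommGroup X] [NormedSpace ℝ X] {p : ℝ} {e : ℕ → X}

theorem etaTilde_le_one (p : ℝ) (e : ℕ → X) (A : ℕ → (ℕ →₀ ℝ)) (n : ℕ) :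
    etaTilde p e A n ≤ 1 :=
  Real.sSup_le (fun _ ht => ht.2.1) zero_le_one

theorem le_etaTilde {A : ℕ → (ℕ →₀ ℝ)} {n : ℕ} {t : ℝ} (h0 : 0 < t) (h1 : t ≤ 1)
    (h : EtaBound p e A n t) : t ≤ etaTilde p e A n :=
  le_csSup ⟨1, fun _ ht => ht.2.1⟩ ⟨h0, h1, h⟩

theorem etaTilde_le_etaOfSeq (p : ℝ) (e : ℕ → X) (A : ℕ → (ℕ →₀ ℝ)) (n K : ℕ) :
    etaTilde p e (fun i => A (i + K)) n ≤ etaOfSeq p e A n :=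
  le_ciSup (f := fun k => etaTilde p e (fun i => A (i + k)) n)
    ⟨1, by rintro _ ⟨k, rfl⟩; exact etaTilde_le_one p e _ n⟩ K

theorem etaOfSeq_nonneg (p : ℝ) (e : ℕ → X) (A : ℕ → (ℕ →₀ ℝ)) (n : ℕ) :
    0 ≤ etaOfSeq p e A n :=
  Real.iSup_nonneg fun _ => Real.sSup_nonneg fun _ ht => ht.1.le

theorem etaConst_le_etaOfSeq {A : ℕ → (ℕ →₀ ℝ)} (hA : SuccBlocks A)
    (hA1 : ∀ i, ‖vec e (A i)‖ = 1) (hr : ∃ r, ∀ i, (A i).support ∈ SchreierNat r) (n : ℕ) :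
    etaConst p e n ≤ etaOfSeq p e A n :=
  csInf_le ⟨0, by rintro _ ⟨B, -, -, -, rfl⟩; exact etaOfSeq_nonneg p e B n⟩ ⟨A, hA, hA1, hr, rfl⟩

theorem exists_normalized_blocks (he : ∀ i, e i ≠ 0) (p : ℝ) (n : ℕ) :
    {r : ℝ | ∃ A : ℕ → (ℕ →₀ ℝ), SuccBlocks A ∧ (∀ i, ‖vec e (A i)‖ = 1) ∧
      (∃ r₀ : ℕ, ∀ i, (A i).support ∈ SchreierNat r₀) ∧ r = etaOfSeq p e A n}.Nonempty := by
  have hne : ∀ i, ‖e i‖ ≠ 0 := fun i => norm_ne_zero_iff.2 (he i)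
  have hsupp : ∀ i, (Finsupp.single i ‖e i‖⁻¹).support = {i} := fun i =>
    Finsupp.support_single i (inv_ne_zero (hne i))
  refine ⟨_, fun i => Finsupp.single i ‖e i‖⁻¹, ⟨fun i => ?_, fun i j hij => ?_⟩, fun i => ?_,
    ⟨0, fun i => ?_⟩, rfl⟩
  · simp [hsupp]
  · simpa [hsupp] using hij
  · simp [vec, norm_smul, hne]
  · simp [hsupp, SchreierNat]

theorem exists_pow_le_etaConst (hp : 1 ≤ p) (he : ∀ i, e i ≠ 0) (hasym : IsAsymptoticLp p e) :
    ∃ q : ℝ, 0 < q ∧ ∀ n, q ^ n ≤ etaConst p e n := by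
  obtain ⟨C, hC, h⟩ := hasym
  have hCp : 1 ≤ C ^ p := Real.one_le_rpow hC (by linarith)
  have hq : 0 < (C ^ p)⁻¹ := by positivity
  refine ⟨(C ^ p)⁻¹, hq, fun n => le_csInf (exists_normalized_blocks he p n) ?_⟩
  rintro _ ⟨A, hA, hA1, -, rfl⟩
  refine (le_etaTilde (by positivity) (pow_le_one₀ hq.le (inv_le_one_of_one_le₀ hCp)) ?_).trans
    (etaTilde_le_etaOfSeq p e A n 0)
  exact etaBound_tail_iff.2 fun F _ hF a => pow_mul_sum_le_of_isAsymptoticLp hp hC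
    (fun n A h1 h2 h3 b => (h n A h1 h2 h3 b).1) hA hA1 a hF

/-- Every tail contains almost optimal combinations for the constant `η_N(x)`. -/
theorem exists_sum_rpow_lt {A : ℕ → (ℕ →₀ ℝ)} (hA : SuccBlocks A)
    (hA1 : ∀ i, ‖vec e (A i)‖ = 1) {N : ℕ} {t : ℝ} (h0 : 0 < t) (ht : etaOfSeq p e A N < t)
    (K : ℕ) :
    ∃ (F : Finset ℕ) (a : ℕ → ℝ), (∀ i ∈ F, K ≤ i) ∧ F.image (minSupp A) ∈ SchreierNat N ∧
      ‖∑ i ∈ F, a i • vec e (A i)‖ ^ p < t * ∑ i ∈ F, |a i| ^ p := by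
  by_cases h1 : t ≤ 1
  · by_contra! hcon
    have hb : EtaBound p e (fun i => A (i + K)) N t :=
      etaBound_tail_iff.2 fun F hK hF a => hcon F a hK hF
    exact absurd ((le_etaTilde h0 h1 hb).trans (etaTilde_le_etaOfSeq p e A N K)) (not_le.2 ht)
  · refine ⟨{K + 1}, fun _ => 1, by simp, ?_, ?_⟩
    · rw [Finset.image_singleton]
      exact SchreierNat.singleton_mem N (by
        have : K + 1 ≤ minSupp A (K + 1) := hA.strictMono_minSupp.id_le _
        omega)
    · simpa [hA1] using h1

theorem exists_tail_lower_bound {A : ℕ → (ℕ →₀ ℝ)} {n : ℕ} {s : ℝ}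
    (hs0 : 0 < s) (hs : s < etaOfSeq p e A n) :
    ∃ K : ℕ, ∀ F : Finset ℕ, (∀ i ∈ F, K ≤ i) → F.image (minSupp A) ∈ SchreierNat n →
      ∀ a : ℕ → ℝ, s * ∑ i ∈ F, |a i| ^ p ≤ ‖∑ i ∈ F, a i • vec e (A i)‖ ^ p := by
  obtain ⟨K, hK⟩ := exists_lt_of_lt_ciSup hs
  have hne : {t : ℝ | 0 < t ∧ t ≤ 1 ∧ EtaBound p e (fun i => A (i + K)) n t}.Nonempty := by
    by_contra h
    rw [Set.not_nonempty_iff_eq_empty] at h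
    rw [etaTilde, h, Real.sSup_empty] at hK
    exact lt_asymm hs0 hK
  obtain ⟨t, ⟨-, -, ht⟩, hst⟩ := exists_lt_of_lt_csSup hne hK
  refine ⟨K, fun F hF1 hF2 a => le_trans ?_ (etaBound_tail_iff.1 ht F hF1 hF2 a)⟩
  gcongr

end EtaConstants

/-- If `f n ^ (1/n) → η`, then `f N / f (N - j)` is at most about `η ^ j` for some large `N` and
all `j` in a bounded range. -/
theorem exists_le_mul_pow_of_tendsto_root {f : ℕ → ℝ} (hf : ∀ n, 0 < f n) {η c : ℝ} (hη0 : 0 < η)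
    (hη : Tendsto (fun n : ℕ => f n ^ (1 / (n : ℝ))) atTop (nhds η)) (hc : 1 < c) (M : ℕ) :
    ∃ N, M ≤ N ∧ ∀ j, 1 ≤ j → j < M → f N ≤ c * η ^ j * f (N - j) := by
  by_contra! hcon
  obtain ⟨lam, hlam, hlamM⟩ : ∃ lam : ℝ, 1 < lam ∧ lam ^ (M + 1) = c := by
    refine ⟨c ^ (((M + 1 : ℕ) : ℝ)⁻¹), Real.one_lt_rpow hc (by positivity), ?_⟩
    exact Real.rpow_inv_natCast_pow (by linarith) (by omega)
  have hlam0 : 0 < lam := by linarith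
  obtain ⟨b, hb0, hb⟩ : ∃ b : ℝ, 0 < b ∧ ∀ n < M, b * (lam * η) ^ n ≤ f n := by
    obtain ⟨n₀, -, hn₀⟩ := (Finset.range (M + 1)).exists_min_image
      (fun n => f n / (lam * η) ^ n) ⟨0, by simp⟩
    refine ⟨f n₀ / (lam * η) ^ n₀, div_pos (hf _) (by positivity), fun n hn => ?_⟩
    exact (le_div_iff₀ (by positivity)).1 (hn₀ n (by simp; omega))
  have hall : ∀ n, b * (lam * η) ^ n ≤ f n := by
    intro n
    induction n using Nat.strong_induction_on with
    | _ n ih =>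
      by_cases hn : n < M
      · exact hb n hn
      · obtain ⟨j, hj1, hjM, hj⟩ := hcon n (by omega)
        have h1 := ih (n - j) (by omega)
        have h2 : lam ^ j ≤ c := hlamM ▸ pow_le_pow_right₀ hlam.le (by omega)
        calc b * (lam * η) ^ n = lam ^ j * η ^ j * (b * (lam * η) ^ (n - j)) := by
              conv_lhs => rw [← Nat.sub_add_cancel (show j ≤ n by omega), pow_add]
              rw [mul_pow lam η j]; ring
          _ ≤ c * η ^ j * f (n - j) := by gcongr
          _ ≤ f n := hj.le
  have hlim : Tendsto (fun n : ℕ => b ^ (1 / (n : ℝ)) * (lam * η)) atTop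
      (nhds (b ^ (0 : ℝ) * (lam * η))) := by
    refine Tendsto.mul_const _ ?_
    exact (Real.continuousAt_const_rpow hb0.ne').tendsto.comp tendsto_one_div_atTop_nhds_zero_nat
  rw [Real.rpow_zero, one_mul] at hlim
  have hle : lam * η ≤ η := by
    refine le_of_tendsto_of_tendsto hlim hη ?_
    filter_upwards [eventually_ge_atTop 1] with n hn
    have h1 := Real.rpow_le_rpow (by positivity) (hall n) (show 0 ≤ 1 / (n : ℝ) by positivity)
    rwa [Real.mul_rpow hb0.le (by positivity), one_div,
      Real.pow_rpow_inv_natCast (by positivity) (by omega), ← one_div] at h1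
  nlinarith

/-- Infinitely many successive finite sets can be chosen from finite sets that exist arbitrarily
far out. -/
theorem exists_successive_finsets {α : Type*} {P : Finset ℕ → α → Prop}
    (h : ∀ K, ∃ F a, (∀ i ∈ F, K ≤ i) ∧ P F a) :
    ∃ (F : ℕ → Finset ℕ) (a : ℕ → α), (∀ s, P (F s) (a s)) ∧
      ∀ s s', s < s' → ∀ i ∈ F s, ∀ i' ∈ F s', i < i' := by
  choose F a hF hP using h
  let t : ℕ → ℕ := fun s => Nat.rec 0 (fun _ K => max K ((F K).sup id + 1)) s
  have ht : ∀ s, t (s + 1) = max (t s) ((F (t s)).sup id + 1) := fun _ => rfl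
  have hmono : Monotone t := monotone_nat_of_le_succ fun s => by
    rw [ht]
    exact le_max_left _ _
  refine ⟨fun s => F (t s), fun s => a (t s), fun s => hP _, fun s s' hs i hi i' hi' => ?_⟩
  have h1 : i ≤ (F (t s)).sup id := Finset.le_sup (f := id) hi
  have h2 := hmono (Nat.succ_le_of_lt hs)
  have h3 := hF _ i' hi'
  have h4 := le_max_right (t s) ((F (t s)).sup id + 1)
  rw [← ht] at h4
  simp only [Nat.succ_eq_add_one] at h2
  omega

section Segments

variable {X : Type*} [NormedAddCommGroup X] [NormedSpace ℝ X] {p : ℝ} {e : ℕ → X}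

/-- A block combination over an `S_{n+j}` index set splits into an `S_j`-admissible family of
combinations over `S_n` sets, each of which satisfies the given lower estimate. -/
theorem SuccBlocks.exists_admissible_lower_bound {A : ℕ → (ℕ →₀ ℝ)} (hA : SuccBlocks A)
    {n j : ℕ} {s : ℝ} {F : Finset ℕ} {a : ℕ → ℝ} (hF : F.image (minSupp A) ∈ SchreierNat (n + j))
    (hs : ∀ G ⊆ F, G.image (minSupp A) ∈ SchreierNat n →
      s * ∑ i ∈ G, |a i| ^ p ≤ ‖∑ i ∈ G, a i • vec e (A i)‖ ^ p) :
    ∃ (k : ℕ) (E : Fin k → Finset ℕ), SAdmissible (SchreierNat j) E ∧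
      s * ∑ i ∈ F, |a i| ^ p ≤ ∑ l, ‖vec e (restr (E l) (blockComb A F a))‖ ^ p := by
  obtain ⟨D, hDF, hDj, hDle, hDn⟩ := SchreierNat.exists_segments hA.strictMono_minSupp hF
  set d := D.orderEmbOfFin rfl
  have hdD : ∀ l, d l ∈ D := fun l => D.orderEmbOfFin_mem rfl l
  have hmin : ∀ l, fmin ((segmentFrom F D (d l)).biUnion fun i => (A i).support)
      = minSupp A (d l) := by
    intro l
    have hself := self_mem_segmentFrom (D := D) (hDF (hdD l))
    have hmem : minSupp A (d l) ∈ (segmentFrom F D (d l)).biUnion fun i => (A i).support :=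
      Finset.mem_biUnion.2 ⟨_, hself, fmin_mem (hA.1 _)⟩
    refine le_antisymm (fmin_le hmem) ?_
    obtain ⟨i, hi, hx⟩ := Finset.mem_biUnion.1 (fmin_mem ⟨_, hmem⟩)
    exact (hA.strictMono_minSupp.monotone (mem_segmentFrom.1 hi).2.1).trans (fmin_le hx)
  refine ⟨D.card, fun l => (segmentFrom F D (d l)).biUnion fun i => (A i).support,
    ⟨?_, ?_, ?_⟩, ?_⟩
  · intro l
    exact ⟨_, Finset.mem_biUnion.2
      ⟨_, self_mem_segmentFrom (hDF (hdD l)), fmin_mem (hA.1 _)⟩⟩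
  · intro l l' hl x hx y hy
    obtain ⟨i, hi, hx⟩ := Finset.mem_biUnion.1 hx
    obtain ⟨i', hi', hy⟩ := Finset.mem_biUnion.1 hy
    exact hA.lt_of_mem (segmentFrom_lt (hdD l') (d.strictMono hl) hi hi') hx hy
  · refine SchreierNat.mono_subset hDj fun x hx => ?_
    obtain ⟨l, -, rfl⟩ := Finset.mem_image.1 hx
    simp only [hmin]
    exact Finset.mem_image_of_mem _ (hdD l)
  · have hsub : ∀ l, segmentFrom F D (d l) ⊆ F := fun l => Finset.filter_subset _ _
    simp only [hA.restr_blockComb (hsub _), vec_blockComb]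
    have hsum : ∑ l, ∑ i ∈ segmentFrom F D (d l), |a i| ^ p = ∑ i ∈ F, |a i| ^ p := by
      rw [← sum_segmentFrom hDle]
      exact sum_orderEmbOfFin D fun d => ∑ i ∈ segmentFrom F D d, |a i| ^ p
    rw [← hsum, Finset.mul_sum]
    exact Finset.sum_le_sum fun l _ => hs _ (hsub l) (hDn _ (hdD l))

end Segments

/-- Let `X` be an asymptotic `ℓ_p` space with a basis, with refined
lower asymptotic constants `(η_n)` and `η = lim_n η_n^{1/n}`.  For every `M` there is
a block sequence `(x_i)` in `X` with `(supp x_i) ⊂ S_r` for some `r`, such that for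
every `i` and every `1 ≤ j < M` there is an `S_j`-admissible sequence `(E_k)` with
`‖x_i‖^p ≤ 2 η^j ∑_k ‖E_k x_i‖^p`. -/
theorem statement2 {X : Type*} [NormedAddCommGroup X] [NormedSpace ℝ X] [CompleteSpace X]
    (p : ℝ) (hp : 1 ≤ p) (e : ℕ → X) (hbasis : IsSchauderBasis e)
    (hasym : IsAsymptoticLp p e)
    (η : ℝ) (hη : Tendsto (fun n : ℕ => etaConst p e n ^ (1 / (n : ℝ))) atTop (nhds η))
    (M : ℕ) :
    ∃ A : ℕ → (ℕ →₀ ℝ), SuccBlocks A ∧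
      (∃ r : ℕ, ∀ i, (A i).support ∈ SchreierNat r) ∧
      ∀ i : ℕ, ∀ j : ℕ, 1 ≤ j → j < M →
        ∃ (k : ℕ) (E : Fin k → Finset ℕ), SAdmissible (SchreierNat j) E ∧
          ‖vec e (A i)‖ ^ p ≤ 2 * η ^ j * ∑ l, ‖vec e (restr (E l) (A i))‖ ^ p := by
  obtain ⟨he, -, -⟩ := hbasis
  obtain ⟨q, hq0, hq⟩ := exists_pow_le_etaConst hp he hasym
  have hpos : ∀ n, 0 < etaConst p e n := fun n => (pow_pos hq0 n).trans_le (hq n)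
  have hη0 : 0 < η := by
    refine hq0.trans_le (ge_of_tendsto hη ?_)
    filter_upwards [eventually_ge_atTop 1] with n hn
    have h1 := Real.rpow_le_rpow (by positivity) (hq n) (show 0 ≤ 1 / (n : ℝ) by positivity)
    rwa [one_div, Real.pow_rpow_inv_natCast hq0.le (by omega), ← one_div] at h1
  obtain ⟨N, hMN, hN⟩ :=
    exists_le_mul_pow_of_tendsto_root hpos hη0 hη (show (1 : ℝ) < 5 / 4 by norm_num) M
  obtain ⟨_, ⟨A, hA, hA1, ⟨r, hr⟩, rfl⟩, hlt⟩ := exists_lt_of_csInf_lt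
    (exists_normalized_blocks he p N) (show etaConst p e N < 5 / 4 * etaConst p e N by
      linarith [hpos N])
  have htail : ∀ n, ∃ K : ℕ, ∀ F : Finset ℕ, (∀ i ∈ F, K ≤ i) →
      F.image (minSupp A) ∈ SchreierNat n → ∀ a : ℕ → ℝ,
      4 / 5 * etaConst p e n * ∑ i ∈ F, |a i| ^ p ≤ ‖∑ i ∈ F, a i • vec e (A i)‖ ^ p := fun n =>
    exists_tail_lower_bound (by linarith [hpos n])
      (lt_of_lt_of_le (by linarith [hpos n]) (etaConst_le_etaOfSeq hA hA1 ⟨r, hr⟩ n))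
  choose K hK using htail
  set K₀ := (Finset.range (N + 1)).sup K
  obtain ⟨F, a, hFa, hsucc⟩ := exists_successive_finsets
    (P := fun F (a : ℕ → ℝ) => (∀ i ∈ F, K₀ ≤ i) ∧ F.image (minSupp A) ∈ SchreierNat N ∧
      ‖∑ i ∈ F, a i • vec e (A i)‖ ^ p < 5 / 4 * etaConst p e N * ∑ i ∈ F, |a i| ^ p)
    (fun L => by
      obtain ⟨F, a, hL, hF⟩ := exists_sum_rpow_lt (p := p) hA hA1
        (by linarith [hpos N]) hlt (max L K₀)
      exact ⟨F, a, fun i hi => (le_max_left _ _).trans (hL i hi),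
        fun i hi => (le_max_right _ _).trans (hL i hi), hF⟩)
  refine ⟨fun s => blockComb A (F s) (a s), ⟨fun s => ?_, fun s s' hs x hx y hy =>
    hA.lt_of_mem_blockComb (hsucc s s' hs) hx hy⟩, ⟨r + N, fun s => ?_⟩, fun s j hj1 hjM => ?_⟩
  · obtain ⟨i, hi, hne⟩ : ∃ i ∈ F s, a s i ≠ 0 := by
      by_contra! h
      have h1 := (hFa s).2.2
      rw [Finset.sum_eq_zero (fun i hi => by simp [h i hi]),
        Finset.sum_eq_zero (fun i hi => by
          rw [h i hi, abs_zero, Real.zero_rpow (by linarith)])] at h1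
      simp [show p ≠ 0 by linarith] at h1
    exact hA.blockComb_support_nonempty hi hne
  · refine SchreierNat.mono_subset (hA.biUnion_support_mem hr (hFa s).2.1) fun x hx => ?_
    obtain ⟨i, hi, hx⟩ := exists_of_mem_support_blockComb hx
    exact Finset.mem_biUnion.2 ⟨i, hi, hx⟩
  · obtain ⟨hK₀, hFN, hlow⟩ := hFa s
    have hKle : K (N - j) ≤ K₀ :=
      Finset.le_sup (f := K) (Finset.mem_range.2 (by omega))
    obtain ⟨k, E, hE, hsum⟩ := hA.exists_admissible_lower_bound (p := p) (e := e) (n := N - j)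
      (j := j) (F := F s) (a := a s) (by rwa [Nat.sub_add_cancel (by omega)])
      (fun G hG hGn => hK (N - j) G (fun i hi => hKle.trans (hK₀ i (hG hi))) hGn (a s))
    refine ⟨k, E, hE, ?_⟩
    have hS : 0 ≤ ∑ i ∈ F s, |a s i| ^ p := Finset.sum_nonneg fun i _ => by positivity
    have hf := hpos (N - j)
    rw [vec_blockComb]
    calc ‖∑ i ∈ F s, a s i • vec e (A i)‖ ^ p
        ≤ 5 / 4 * etaConst p e N * ∑ i ∈ F s, |a s i| ^ p := hlow.le
      _ ≤ 5 / 4 * (5 / 4 * η ^ j * etaConst p e (N - j)) * ∑ i ∈ F s, |a s i| ^ p := by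
          gcongr
          exact hN j hj1 hjM
      _ ≤ 2 * η ^ j * (4 / 5 * etaConst p e (N - j) * ∑ i ∈ F s, |a s i| ^ p) := by
          have : 0 ≤ η ^ j * etaConst p e (N - j) * ∑ i ∈ F s, |a s i| ^ p := by positivity
          nlinarith
      _ ≤ 2 * η ^ j * ∑ l, ‖vec e (restr (E l) (blockComb A (F s) (a s)))‖ ^ p := by
          gcongr
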